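/- arXiv:0807.0620 — 2 statements merged into one kernel-verified Lean document; each statement's English description precedes it below -/
import Mathlib

section
/- For every l ∈ ℤ and every integer m ≥ 0, each matrix B_{(0,0,0)}^y with y ∈ V is (l,m)-equivalent to B_{(0,0,0)}^0 or to B_{(0,0,0)}^∞. Moreover, when m = 0 the two matrices B_{(0,0,0)}^0 and B_{(0,0,0)}^∞ are (l,0)-equivalent to each other. -/
open Matrix

noncomputable section

variable (p : ℕ) [Fact p.Prime]

/-- The 4×4 symplectic similitude matrix `J`. -/
def Jmat : Matrix (Fin 4) (Fin 4) ℚ_[p] :=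
  !![0,0,1,0; 0,0,0,1; -1,0,0,0; 0,-1,0,0]

/-- `GSp₄(ℚ_p)`. -/
def GSp4 : Set (Matrix (Fin 4) (Fin 4) ℚ_[p]) :=
  {g | IsUnit g.det ∧ ∃ μ : ℚ_[p]ˣ, gᵀ * Jmat p * g = (μ : ℚ_[p]) • Jmat p}

/-- `K_p = GSp₄(ℤ_p)`, viewed inside `GSp₄(ℚ_p)`. -/
def Kp : Set (Matrix (Fin 4) (Fin 4) ℚ_[p]) :=
  {g | g ∈ GSp4 p ∧ (∀ i j, ‖g i j‖ ≤ 1) ∧ ‖g.det‖ = 1}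

/-- The Iwahori subgroup `I_p`: elements of `K_p` whose reduction mod `p` has zero
entries at positions (1,2), (3,1), (3,2), (4,1), (4,2), (4,3) (0-indexed below). -/
def Ip : Set (Matrix (Fin 4) (Fin 4) ℚ_[p]) :=
  {g | g ∈ Kp p ∧ ‖g 0 1‖ < 1 ∧ ‖g 2 0‖ < 1 ∧ ‖g 2 1‖ < 1 ∧
      ‖g 3 0‖ < 1 ∧ ‖g 3 1‖ < 1 ∧ ‖g 3 2‖ < 1}

/-- The matrix `U_x` for `x = (n,q,r)`. -/
def Umat (n q r : ℚ_[p]) : Matrix (Fin 4) (Fin 4) ℚ_[p] :=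
  !![1,0,n,q; 0,1,q,r; 0,0,1,0; 0,0,0,1]

/-- The matrix `Z_y` for `y ∈ ℤ_p`. -/
def Zmat (y : ℚ_[p]) : Matrix (Fin 4) (Fin 4) ℚ_[p] :=
  !![1,y,0,0; 0,1,0,0; 0,0,1,0; 0,0,-y,1]

/-- The matrix `Z_∞`. -/
def Zinf : Matrix (Fin 4) (Fin 4) ℚ_[p] :=
  !![0,1,0,0; 1,0,0,0; 0,0,0,1; 0,0,1,0]

/-- `Z_v` for `v ∈ V = Y ∪ {∞}`, where `Y = {0,…,p−1}` is modelled by `Fin p`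
and `∞` by `none`. -/
def ZV : Option (Fin p) → Matrix (Fin 4) (Fin 4) ℚ_[p]
  | some y => Zmat p (y.val : ℚ_[p])
  | none => Zinf p

/-- Class A matrices `A_x^y = U_x · J · Z_y`. -/
def Amat (x : Fin p × Fin p × Fin p) (v : Option (Fin p)) : Matrix (Fin 4) (Fin 4) ℚ_[p] :=
  Umat p (x.1.val : ℚ_[p]) (x.2.1.val : ℚ_[p]) (x.2.2.val : ℚ_[p]) * Jmat p * ZV p v

/-- Class B matrices `B_x^y = J · U_x · J · Z_y`. -/
def Bmat (x : Fin p × Fin p × Fin p) (v : Option (Fin p)) : Matrix (Fin 4) (Fin 4) ℚ_[p] :=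
  Jmat p * Umat p (x.1.val : ℚ_[p]) (x.2.1.val : ℚ_[p]) (x.2.2.val : ℚ_[p]) * Jmat p * ZV p v

/-- Assemble a 4×4 matrix from 2×2 blocks. -/
def blk (A B C D : Matrix (Fin 2) (Fin 2) ℚ_[p]) : Matrix (Fin 4) (Fin 4) ℚ_[p] :=
  Matrix.reindex finSumFinEquiv finSumFinEquiv (fromBlocks A B C D)

variable (a b c : ℚ_[p])

/-- The matrix `S = (a, b/2; b/2, c)`. -/
def Smat : Matrix (Fin 2) (Fin 2) ℚ_[p] := !![a, b/2; b/2, c]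

/-- The matrix `ξ = (b/2, c; −a, −b/2)`. -/
def xiS : Matrix (Fin 2) (Fin 2) ℚ_[p] := !![b/2, c; -a, -b/2]

/-- The torus `T(ℚ_p) = {g ∈ GL₂(ℚ_p) : gᵀSg = det(g)·S}`. -/
def Tgrp : Set (Matrix (Fin 2) (Fin 2) ℚ_[p]) :=
  {g | IsUnit g.det ∧ gᵀ * Smat p a b c * g = g.det • Smat p a b c}

/-- The embedding `g ↦ diag(g, det(g)·(g⁻¹)ᵀ)` of `GL₂` into `GSp₄`. -/
def emb (g : Matrix (Fin 2) (Fin 2) ℚ_[p]) : Matrix (Fin 4) (Fin 4) ℚ_[p] :=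
  blk p g 0 0 (g.det • (g⁻¹)ᵀ)

/-- The unipotent group `U(ℚ_p)`. -/
def Ugrp : Set (Matrix (Fin 4) (Fin 4) ℚ_[p]) :=
  {u | ∃ X : Matrix (Fin 2) (Fin 2) ℚ_[p], Xᵀ = X ∧ u = blk p 1 X 0 1}

/-- The Bessel group `R(ℚ_p) = T(ℚ_p)·U(ℚ_p)` inside `GSp₄(ℚ_p)`. -/
def Rgrp : Set (Matrix (Fin 4) (Fin 4) ℚ_[p]) :=
  {r | ∃ t ∈ Tgrp p a b c, ∃ u ∈ Ugrp p, r = emb p t * u}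

/-- `h(l,m) = diag(p^{2m+l}, p^{m+l}, 1, p^m)`. -/
def hmat (l : ℤ) (m : ℕ) : Matrix (Fin 4) (Fin 4) ℚ_[p] :=
  diagonal ![(p : ℚ_[p]) ^ (2 * (m : ℤ) + l), (p : ℚ_[p]) ^ ((m : ℤ) + l), 1, (p : ℚ_[p]) ^ (m : ℤ)]

/-- `(l,m)`-equivalence: `f ~ g` iff `r·h(l,m)·f·k = h(l,m)·g` for some
`r ∈ R(ℚ_p)`, `k ∈ I_p`. -/
def LMEquiv (l : ℤ) (m : ℕ) (f g : Matrix (Fin 4) (Fin 4) ℚ_[p]) : Prop :=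
  ∃ r ∈ Rgrp p a b c, ∃ k ∈ Ip p, r * hmat p l m * f * k = hmat p l m * g

/-- The element of the torus with bottom row `(-u a, x)`. -/
def torusMat (x u : ℚ_[p]) : Matrix (Fin 2) (Fin 2) ℚ_[p] :=
  !![x + u * b, u * c; -(u * a), x]

lemma det_torusMat (x u : ℚ_[p]) :
    (torusMat p a b c x u).det = x ^ 2 + u * b * x + u ^ 2 * a * c := by
  simp only [torusMat, det_fin_two_of]
  ring

lemma torusMat_mem_Tgrp {x u : ℚ_[p]} (h : (torusMat p a b c x u).det ≠ 0) :
    torusMat p a b c x u ∈ Tgrp p a b c := by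
  refine ⟨h.isUnit, ?_⟩
  rw [det_torusMat]
  ext i j
  fin_cases i <;> fin_cases j <;>
    simp [torusMat, Smat, Matrix.mul_apply, Fin.sum_univ_two] <;> ring

lemma blk_of (a₁ a₂ a₃ a₄ b₁ b₂ b₃ b₄ c₁ c₂ c₃ c₄ d₁ d₂ d₃ d₄ : ℚ_[p]) :
    blk p !![a₁, a₂; a₃, a₄] !![b₁, b₂; b₃, b₄] !![c₁, c₂; c₃, c₄] !![d₁, d₂; d₃, d₄] =
      !![a₁, a₂, b₁, b₂; a₃, a₄, b₃, b₄; c₁, c₂, d₁, d₂; c₃, c₄, d₃, d₄] := by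
  ext i j
  fin_cases i <;> fin_cases j <;> rfl

lemma emb_of {x y z w : ℚ_[p]} (h : !![x, y; z, w].det ≠ 0) :
    emb p !![x, y; z, w] = !![x, y, 0, 0; z, w, 0, 0; 0, 0, w, -z; 0, 0, -y, x] := by
  have hinv : (!![x, y; z, w].det • (!![x, y; z, w]⁻¹)ᵀ) = !![w, -z; -y, x] := by
    rw [Matrix.inv_def, Ring.inverse_eq_inv', adjugate_fin_two_of, transpose_smul, smul_smul,
      mul_inv_cancel₀ h, one_smul]
    ext i j
    fin_cases i <;> fin_cases j <;> rfl
  have hzero : (0 : Matrix (Fin 2) (Fin 2) ℚ_[p]) = !![0, 0; 0, 0] := by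
    ext i j
    fin_cases i <;> fin_cases j <;> rfl
  rw [emb, hinv, hzero, blk_of]

lemma one_mem_Ugrp : (1 : Matrix (Fin 4) (Fin 4) ℚ_[p]) ∈ Ugrp p :=
  ⟨0, transpose_zero, by simp [blk]⟩

lemma torusMat_mem_Rgrp {x u : ℚ_[p]} (h : (torusMat p a b c x u).det ≠ 0) :
    !![x + u * b, u * c, 0, 0; -(u * a), x, 0, 0; 0, 0, x, u * a; 0, 0, -(u * c), x + u * b] ∈
      Rgrp p a b c := by
  refine ⟨_, torusMat_mem_Tgrp p a b c h, 1, one_mem_Ugrp p, ?_⟩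
  rw [mul_one, torusMat, emb_of p h, neg_neg]

/-- A block-diagonal element of the Iwahori subgroup. -/
def leviMat (α β γ s : ℚ_[p]) : Matrix (Fin 4) (Fin 4) ℚ_[p] :=
  !![α, 0, 0, 0; β, γ, 0, 0; 0, 0, s * γ, -(s * β); 0, 0, 0, s * α]

lemma det_leviMat (α β γ s : ℚ_[p]) : (leviMat p α β γ s).det = (s * α * γ) ^ 2 := by
  simp [leviMat, det_succ_row_zero, Fin.sum_univ_succ, Fin.succAbove]
  ring

lemma leviMat_mem_Ip {α β γ s : ℚ_[p]} (hα : ‖α‖ = 1) (hβ : ‖β‖ ≤ 1) (hγ : ‖γ‖ = 1)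
    (hs : ‖s‖ = 1) : leviMat p α β γ s ∈ Ip p := by
  have hnorm : ‖s * α * γ‖ = 1 := by simp [hα, hγ, hs]
  have hne : s * α * γ ≠ 0 := norm_ne_zero_iff.1 (by simp [hnorm])
  have hdet : ‖(leviMat p α β γ s).det‖ = 1 := by rw [det_leviMat, norm_pow, hnorm, one_pow]
  refine ⟨⟨⟨(norm_ne_zero_iff.1 (by simp [hdet])).isUnit, Units.mk0 _ hne, ?_⟩, ?_, hdet⟩, ?_⟩
  · ext i j
    fin_cases i <;> fin_cases j <;>
      simp [leviMat, Jmat, Matrix.mul_apply, Fin.sum_univ_four] <;> ring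
  · intro i j
    fin_cases i <;> fin_cases j <;> simp [leviMat, hα, hβ, hγ, hs]
  · simp [leviMat]

lemma Bmat_zero [NeZero p] (v : Option (Fin p)) : Bmat p (0, 0, 0) v = -ZV p v := by
  have h : Jmat p * Umat p 0 0 0 * Jmat p = -1 := by
    ext i j
    fin_cases i <;> fin_cases j <;>
      simp [Jmat, Umat, Matrix.mul_apply, Fin.sum_univ_four]
  simp [Bmat, h]

lemma hmat_eq (l : ℤ) (m : ℕ) :
    hmat p l m = !![(p : ℚ_[p]) ^ (2 * (m : ℤ) + l), 0, 0, 0; 0, (p : ℚ_[p]) ^ ((m : ℤ) + l), 0, 0;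
      0, 0, 1, 0; 0, 0, 0, (p : ℚ_[p]) ^ (m : ℤ)] := by
  ext i j
  fin_cases i <;> fin_cases j <;> rfl

lemma LMEquiv.refl (l : ℤ) (m : ℕ) (f : Matrix (Fin 4) (Fin 4) ℚ_[p]) :
    LMEquiv p a b c l m f f := by
  refine ⟨_, torusMat_mem_Rgrp p a b c (x := 1) (u := 0) (by simp [det_torusMat]),
    _, leviMat_mem_Ip p (α := 1) (β := 0) (γ := 1) (s := 1) (by simp) (by simp) (by simp)
      (by simp), ?_⟩
  have h₁ : (!![1 + 0 * b, 0 * c, 0, 0; -(0 * a), 1, 0, 0; 0, 0, 1, 0 * a;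
      0, 0, -(0 * c), 1 + 0 * b] : Matrix (Fin 4) (Fin 4) ℚ_[p]) = 1 := by
    ext i j
    fin_cases i <;> fin_cases j <;> simp
  have h₂ : leviMat p 1 0 1 1 = 1 := by
    ext i j
    fin_cases i <;> fin_cases j <;> simp [leviMat]
  rw [h₁, h₂, one_mul, mul_one]

/-- A quadratic polynomial over `ℤ_p` with non-square unit discriminant takes only unit values
on `ℤ_p`. -/
lemma norm_quadratic_eq_one {a b c y : ℚ_[p]} (ha : ‖a‖ ≤ 1) (hb : ‖b‖ ≤ 1) (hc : ‖c‖ ≤ 1)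
    (hy : ‖y‖ ≤ 1) (hd : ‖b ^ 2 - 4 * a * c‖ = 1)
    (hnsq : ∀ z : ℚ_[p], z ^ 2 ≠ b ^ 2 - 4 * a * c) :
    ‖a * y ^ 2 + b * y + c‖ = 1 := by
  obtain ⟨a, rfl⟩ : ∃ a' : ℤ_[p], (a' : ℚ_[p]) = a := ⟨⟨a, ha⟩, rfl⟩
  obtain ⟨b, rfl⟩ : ∃ b' : ℤ_[p], (b' : ℚ_[p]) = b := ⟨⟨b, hb⟩, rfl⟩
  obtain ⟨c, rfl⟩ : ∃ c' : ℤ_[p], (c' : ℚ_[p]) = c := ⟨⟨c, hc⟩, rfl⟩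
  obtain ⟨y, rfl⟩ : ∃ y' : ℤ_[p], (y' : ℚ_[p]) = y := ⟨⟨y, hy⟩, rfl⟩
  have hd' : ‖b ^ 2 - 4 * a * c‖ = 1 := by exact_mod_cast hd
  have hsum : (2 * a * y + b) ^ 2 = b ^ 2 - 4 * a * c + 4 * a * (a * y ^ 2 + b * y + c) := by ring
  by_contra hne
  have hlt : ‖a * y ^ 2 + b * y + c‖ < 1 :=
    lt_of_le_of_ne (PadicInt.norm_le_one _) fun h => hne (by exact_mod_cast h)
  have hsmall : ‖4 * a * (a * y ^ 2 + b * y + c)‖ < 1 := by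
    rw [norm_mul]
    exact mul_lt_one_of_nonneg_of_lt_one_right (PadicInt.norm_le_one _) (norm_nonneg _) hlt
  have hderiv : ‖2 * a * y + b‖ ^ 2 = 1 := by
    rw [← norm_pow, hsum, PadicInt.norm_add_eq_max_of_ne (by rw [hd']; exact hsmall.ne'), hd',
      max_eq_left hsmall.le]
  obtain ⟨z, hz, -⟩ := hensels_lemma (p := p)
    (F := .C a * .X ^ 2 + .C b * .X + .C c) (a := y) (by
      have h : (Polynomial.derivative (.C a * .X ^ 2 + .C b * .X + .C c)).aeval y =
          2 * a * y + b := by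
        simp
        ring
      rw [h, hderiv]
      simpa using hlt)
  have hz' : a * z ^ 2 + b * z + c = 0 := by simpa using hz
  refine hnsq ((2 * a * z + b : ℤ_[p]) : ℚ_[p]) ?_
  have : (2 * a * z + b) ^ 2 = b ^ 2 - 4 * a * c := by linear_combination 4 * a * hz'
  exact_mod_cast congrArg ((↑) : ℤ_[p] → ℚ_[p]) this

theorem classB_zero_equivalent [NeZero p]
    (ha : ‖a‖ = 1) (hb : ‖b‖ ≤ 1) (hc : ‖c‖ = 1)
    (hd : ‖b ^ 2 - 4 * a * c‖ = 1)
    (hnsq : ∀ z : ℚ_[p], z ^ 2 ≠ b ^ 2 - 4 * a * c) :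
    (∀ (l : ℤ) (m : ℕ) (v : Option (Fin p)),
      LMEquiv p a b c l m (Bmat p (0, 0, 0) v) (Bmat p (0, 0, 0) (some 0)) ∨
      LMEquiv p a b c l m (Bmat p (0, 0, 0) v) (Bmat p (0, 0, 0) none)) ∧
    (∀ l : ℤ,
      LMEquiv p a b c l 0 (Bmat p (0, 0, 0) (some 0)) (Bmat p (0, 0, 0) none)) := by
  have hp : (p : ℚ_[p]) ≠ 0 := by exact_mod_cast (Fact.out : p.Prime).ne_zero
  have ha0 : a ≠ 0 := norm_ne_zero_iff.1 (by simp [ha])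
  have hc0 : c ≠ 0 := norm_ne_zero_iff.1 (by simp [hc])
  refine ⟨fun l m v => ?_, fun l => ?_⟩
  · obtain _ | y := v
    · exact Or.inr (LMEquiv.refl p a b c l m _)
    · left
      have hpn (n : ℕ) : ‖(p : ℚ_[p]) ^ n‖ ≤ 1 := by
        exact_mod_cast Padic.norm_int_le_one ((p : ℤ) ^ n)
      have hyn : ‖(y.val : ℚ_[p])‖ ≤ 1 := by
        exact_mod_cast Padic.norm_int_le_one (p := p) (y.val : ℤ)
      simp only [Bmat_zero, ZV, Fin.val_zero, Nat.cast_zero]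
      generalize (y.val : ℚ_[p]) = y at hyn ⊢
      obtain ⟨P, hP⟩ : ∃ P : ℚ_[p], P = (p : ℚ_[p]) ^ m := ⟨_, rfl⟩
      have hPn : ‖P‖ ≤ 1 := hP ▸ hpn m
      obtain ⟨N, hN⟩ : ∃ N : ℚ_[p], N = a * (P * y) ^ 2 + b * (P * y) + c := ⟨_, rfl⟩
      have hN1 : ‖N‖ = 1 := hN ▸ norm_quadratic_eq_one p ha.le hb hc.le
        (by rw [norm_mul]; exact mul_le_one₀ hPn (norm_nonneg _) hyn) hd hnsq
      have hN0 : N ≠ 0 := norm_ne_zero_iff.1 (by simp [hN1])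
      have hdet : (torusMat p a b c (c + P * y * b) (-(P * y))).det ≠ 0 := by
        have : (torusMat p a b c (c + P * y * b) (-(P * y))).det = c * N := by
          rw [det_torusMat, hN]
          ring
        rw [this]
        exact mul_ne_zero hc0 hN0
      refine ⟨_, torusMat_mem_Rgrp p a b c hdet, _,
        leviMat_mem_Ip p (α := c⁻¹) (β := -(P ^ 2 * y * a * (c⁻¹ * N⁻¹))) (γ := N⁻¹) (s := 1)
          (by simp [hc]) ?_ (by simp [hN1]) (by simp), ?_⟩
      · simp only [norm_neg, norm_mul, norm_inv, norm_pow, ha, hc, hN1, inv_one, mul_one]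
        exact mul_le_one₀ (pow_le_one₀ (norm_nonneg _) hPn) (norm_nonneg _) hyn
      · have h₁ : (p : ℚ_[p]) ^ (2 * (m : ℤ) + l) = P ^ 2 * (p : ℚ_[p]) ^ l := by
          rw [zpow_add₀ hp, mul_comm 2, _root_.zpow_mul, hP]
          norm_cast
        have h₂ : (p : ℚ_[p]) ^ ((m : ℤ) + l) = P * (p : ℚ_[p]) ^ l := by
          rw [zpow_add₀ hp, hP]
          norm_cast
        have h₃ : (p : ℚ_[p]) ^ (m : ℤ) = P := by rw [hP]; norm_cast
        rw [hmat_eq, h₁, h₂, h₃]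
        ext i j
        fin_cases i <;> fin_cases j <;>
          simp [leviMat, Zmat, Matrix.mul_apply, Fin.sum_univ_four] <;>
          field_simp <;> simp only [hN] <;> first | ring1 | exact Or.inl (by ring)
  · simp only [Bmat_zero, ZV, Fin.val_zero, Nat.cast_zero]
    have hdet : (torusMat p a b c 0 1).det ≠ 0 := by
      simp [det_torusMat, ha0, hc0]
    refine ⟨_, torusMat_mem_Rgrp p a b c hdet, _,
      leviMat_mem_Ip p (α := -a⁻¹) (β := b * (a⁻¹ * c⁻¹)) (γ := c⁻¹) (s := -1)
        (by simp [ha]) (by simp [ha, hc, hb]) (by simp [hc]) (by simp), ?_⟩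
    rw [hmat_eq]
    ext i j
    fin_cases i <;> fin_cases j <;>
      simp [leviMat, Zmat, Zinf, Matrix.mul_apply, Fin.sum_univ_four] <;>
      field_simp <;> ring
end
end

section
/- For every l ∈ ℤ, the matrices B_{(1,0,0)}^0 and B_{(0,0,1)}^∞ are (l,0)-equivalent, and the matrices B_{(1,0,0)}^∞ and B_{(0,0,1)}^0 are (l,0)-equivalent. -/
open Matrix

noncomputable section

variable (p : ℕ) [Fact p.Prime]

variable (a b c : ℚ_[p])

/-- The torus element `(-b, -c; a, 0) / (ac)`: the inverse of `ξ - b/2` in the torus. -/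
def swapTorus : Matrix (Fin 2) (Fin 2) ℚ_[p] := !![-b/(a*c), -1/a; 1/c, 0]

/-- The symmetric matrix giving the unipotent part of the Bessel element
that relates the two class B matrices; `s` is the similitude `p ^ l` of `h(l,0)`. -/
def swapSym (s : ℚ_[p]) : Matrix (Fin 2) (Fin 2) ℚ_[p] :=
  !![s * ((a - c) / a), s * (b / a); s * (b / a), -(s * (b ^ 2 * (a + c) / (a * c ^ 2)))]

variable {p a b c}

theorem blk_eq (A B C D : Matrix (Fin 2) (Fin 2) ℚ_[p]) :
    blk p A B C D =
      !![A 0 0, A 0 1, B 0 0, B 0 1; A 1 0, A 1 1, B 1 0, B 1 1;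
         C 0 0, C 0 1, D 0 0, D 0 1; C 1 0, C 1 1, D 1 0, D 1 1] := by
  ext i j
  fin_cases i <;> fin_cases j <;> rfl

theorem hmat_zero_right (l : ℤ) :
    hmat p l 0 = !![(p : ℚ_[p]) ^ l, 0, 0, 0; 0, (p : ℚ_[p]) ^ l, 0, 0; 0, 0, 1, 0; 0, 0, 0, 1] := by
  ext i j
  fin_cases i <;> fin_cases j <;> simp [hmat]

theorem Jmat_mul_Umat_mul_Jmat (n q r : ℚ_[p]) :
    Jmat p * Umat p n q r * Jmat p = !![-1,0,0,0; 0,-1,0,0; n,q,-1,0; q,r,0,-1] := by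
  ext i j
  fin_cases i <;> fin_cases j <;>
    simp [Jmat, Umat, Matrix.mul_apply, Fin.sum_univ_four]

theorem fin_one_val_cast [NeZero p] : (((1 : Fin p).val : ℕ) : ℚ_[p]) = 1 := by
  have h : (1 : Fin p).val = 1 := by
    rw [Fin.val_one', Nat.mod_eq_of_lt (Fact.out : p.Prime).one_lt]
  rw [h, Nat.cast_one]

theorem Zmat_zero : Zmat p 0 = 1 := by
  ext i j
  fin_cases i <;> fin_cases j <;> simp [Zmat]

theorem det_swapTorus (hc0 : c ≠ 0) : (swapTorus p a b c).det = 1 / (a * c) := by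
  rw [swapTorus, Matrix.det_fin_two_of]
  field_simp
  ring

theorem swapTorus_mem (ha0 : a ≠ 0) (hc0 : c ≠ 0) : swapTorus p a b c ∈ Tgrp p a b c := by
  refine ⟨?_, ?_⟩
  · rw [det_swapTorus hc0]
    exact (one_div_ne_zero (mul_ne_zero ha0 hc0)).isUnit
  · rw [det_swapTorus hc0]
    ext i j
    fin_cases i <;> fin_cases j <;>
      simp [swapTorus, Smat, Matrix.mul_apply, Fin.sum_univ_two] <;> field_simp <;> ring

theorem emb_swapTorus (ha0 : a ≠ 0) (hc0 : c ≠ 0) :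
    emb p (swapTorus p a b c) =
      !![-b/(a*c), -1/a, 0, 0; 1/c, 0, 0, 0; 0, 0, 0, -1/c; 0, 0, 1/a, -b/(a*c)] := by
  have h : (swapTorus p a b c).det • ((swapTorus p a b c)⁻¹)ᵀ
      = !![0, -1/c; 1/a, -b/(a*c)] := by
    have hdet : (swapTorus p a b c).det ≠ 0 := by
      rw [det_swapTorus hc0]
      exact one_div_ne_zero (mul_ne_zero ha0 hc0)
    rw [Matrix.inv_def, Ring.inverse_eq_inv', Matrix.transpose_smul, smul_smul,
      mul_inv_cancel₀ hdet, one_smul, swapTorus, Matrix.adjugate_fin_two_of]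
    ext i j
    fin_cases i <;> fin_cases j <;> simp [div_eq_mul_inv, mul_comm]
  rw [emb, h, blk_eq]
  ext i j
  fin_cases i <;> fin_cases j <;> simp [swapTorus, div_eq_mul_inv, mul_comm]

theorem emb_swapTorus_mul_mem (ha0 : a ≠ 0) (hc0 : c ≠ 0) (s : ℚ_[p]) :
    emb p (swapTorus p a b c) * blk p 1 (swapSym p a b c s) 0 1 ∈ Rgrp p a b c := by
  refine ⟨_, swapTorus_mem ha0 hc0, _, ⟨_, ?_, rfl⟩, rfl⟩
  ext i j
  fin_cases i <;> fin_cases j <;> simp [swapSym]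

theorem swapElement_mul_hmat (ha0 : a ≠ 0) (hc0 : c ≠ 0) (l : ℤ) :
    emb p (swapTorus p a b c) * blk p 1 (swapSym p a b c ((p : ℚ_[p]) ^ l)) 0 1 * hmat p l 0 =
      !![-((p : ℚ_[p]) ^ l * (b / (a * c))), -((p : ℚ_[p]) ^ l / a),
          -((p : ℚ_[p]) ^ l * (b / (a * c))), (p : ℚ_[p]) ^ l * (b ^ 2 / (a * c ^ 2));
        (p : ℚ_[p]) ^ l / c, 0, (p : ℚ_[p]) ^ l * ((a - c) / (a * c)),
          (p : ℚ_[p]) ^ l * (b / (a * c));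
        0, 0, 0, -1 / c; 0, 0, 1 / a, -b / (a * c)] := by
  rw [emb_swapTorus ha0 hc0, blk_eq, hmat_zero_right]
  generalize (p : ℚ_[p]) ^ l = s
  ext i j
  fin_cases i <;> fin_cases j <;>
    simp [swapSym, Matrix.mul_apply, Fin.sum_univ_four] <;> field_simp <;> ring

/-- Integral symplectic similitudes that are block upper triangular with diagonal Levi part
lie in the Iwahori subgroup. -/
theorem mem_Ip_of_diagonal_levi {x y z w e f g h : ℚ_[p]} (hx : ‖x‖ = 1) (hy : ‖y‖ = 1)
    (hz : ‖z‖ = 1) (hw : ‖w‖ = 1) (he : ‖e‖ ≤ 1) (hf : ‖f‖ ≤ 1) (hg : ‖g‖ ≤ 1) (hh : ‖h‖ ≤ 1)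
    (hmul : x * z = y * w) (hsymm : z * f = w * g) :
    !![x, 0, e, f; 0, y, g, h; 0, 0, z, 0; 0, 0, 0, w] ∈ Ip p := by
  have hdet : (!![x, 0, e, f; 0, y, g, h; 0, 0, z, 0; 0, 0, 0, w]).det = x * y * z * w := by
    simp [Matrix.det_succ_row_zero, Fin.sum_univ_succ, Fin.succAbove]
    ring
  have hne : ∀ {t : ℚ_[p]}, ‖t‖ = 1 → t ≠ 0 := fun ht => norm_ne_zero_iff.mp (by simp [ht])
  refine ⟨⟨⟨?_, Units.mk0 (x * z) (mul_ne_zero (hne hx) (hne hz)), ?_⟩, ?_, ?_⟩, ?_⟩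
  · rw [hdet]
    exact (mul_ne_zero (mul_ne_zero (mul_ne_zero (hne hx) (hne hy)) (hne hz)) (hne hw)).isUnit
  · ext i j
    fin_cases i <;> fin_cases j <;>
      simp [Jmat, Matrix.mul_apply, Fin.sum_univ_four] <;> grind
  · intro i j
    fin_cases i <;> fin_cases j <;> simp [*]
  · simp [hdet, hx, hy, hz, hw]
  · simp

variable (p a b c)

theorem classB_claim7_equivalent [NeZero p]
    (ha : ‖a‖ = 1) (hb : ‖b‖ ≤ 1) (hc : ‖c‖ = 1)
    (hd : ‖b ^ 2 - 4 * a * c‖ = 1)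
    (hnsq : ∀ z : ℚ_[p], z ^ 2 ≠ b ^ 2 - 4 * a * c)
    (l : ℤ) :
    LMEquiv p a b c l 0 (Bmat p (1, 0, 0) (some 0)) (Bmat p (0, 0, 1) none) ∧
    LMEquiv p a b c l 0 (Bmat p (1, 0, 0) none) (Bmat p (0, 0, 1) (some 0)) := by
  have ha0 : a ≠ 0 := norm_ne_zero_iff.mp (by simp [ha])
  have hc0 : c ≠ 0 := norm_ne_zero_iff.mp (by simp [hc])
  have hca : ‖c - a‖ ≤ 1 := by
    simpa [ha, hc, sub_eq_add_neg] using Padic.nonarchimedean c (-a)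
  have hbc : ‖-(b ^ 2 / c)‖ ≤ 1 := by
    rw [norm_neg, norm_div, norm_pow, hc, div_one]
    exact pow_le_one₀ (norm_nonneg b) hb
  refine ⟨⟨_, emb_swapTorus_mul_mem ha0 hc0 ((p : ℚ_[p]) ^ l),
      !![a, 0, c - a, b; 0, -a, -b, -(b ^ 2 / c); 0, 0, c, 0; 0, 0, 0, -c],
      mem_Ip_of_diagonal_levi ha (by simpa) hc (by simpa) hca hb (by simpa) hbc
        (by ring) (by ring), ?_⟩,
    ⟨_, emb_swapTorus_mul_mem ha0 hc0 ((p : ℚ_[p]) ^ l),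
      !![-a, 0, -(b ^ 2 / c), -b; 0, a, b, c - a; 0, 0, -c, 0; 0, 0, 0, c],
      mem_Ip_of_diagonal_levi (by simpa) ha (by simpa) hc hbc (by simpa) hb hca
        (by ring) (by ring), ?_⟩⟩
  · rw [swapElement_mul_hmat ha0 hc0, Bmat, Bmat, Jmat_mul_Umat_mul_Jmat, Jmat_mul_Umat_mul_Jmat,
      hmat_zero_right]
    simp only [fin_one_val_cast, ZV, Fin.val_zero, Nat.cast_zero, Zmat_zero, mul_one, Zinf]
    ext i j
    fin_cases i <;> fin_cases j <;>
      simp [Matrix.mul_apply, Fin.sum_univ_four] <;> field_simp <;> ring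
  · rw [swapElement_mul_hmat ha0 hc0, Bmat, Bmat, Jmat_mul_Umat_mul_Jmat, Jmat_mul_Umat_mul_Jmat,
      hmat_zero_right]
    simp only [fin_one_val_cast, ZV, Fin.val_zero, Nat.cast_zero, Zmat_zero, mul_one, Zinf]
    ext i j
    fin_cases i <;> fin_cases j <;>
      simp [Matrix.mul_apply, Fin.sum_univ_four] <;> field_simp <;> ring
end
end
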